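/- arXiv:1807.07444 — 2 statements merged into one kernel-verified Lean document; each statement's English description precedes it below -/
import Mathlib

section
/- Let s ∈ (0,1), q ∈ [2, 6/(3−2s)), R > 0, and let (u_n) be a sequence of measurable functions ℝ³ → ℝ such that sup_n ( ∫_{ℝ³} u_n² dx + ∬_{ℝ³×ℝ³} (u_n(x) − u_n(y))²/|x−y|^{3+2s} dx dy ) < ∞. If lim_{n→∞} sup_{y ∈ ℝ³} ∫_{B_R(y)} |u_n|^q dx = 0, then for every r ∈ (2, 6/(3−2s)) one has ∫_{ℝ³} |u_n|^r dx → 0 as n → ∞. -/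
open MeasureTheory Filter
open scoped ENNReal

noncomputable section

namespace VanishingAux

abbrev E3 := EuclideanSpace ℝ (Fin 3)

/-- volume of the unit ball -/
def cv : ℝ := (volume (Metric.ball (0 : E3) 1)).toReal

lemma cv_pos : 0 < cv :=
  ENNReal.toReal_pos (Metric.measure_ball_pos volume _ one_pos).ne' measure_ball_lt_top.ne

lemma vol_ball (x : E3) {ρ : ℝ} (hρ : 0 < ρ) :
    volume (Metric.ball x ρ) = ENNReal.ofReal (cv * ρ ^ 3) := by
  rw [Measure.addHaar_ball volume x hρ.le, mul_comm, ENNReal.ofReal_mul cv_pos.le, cv,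
    ENNReal.ofReal_toReal measure_ball_lt_top.ne]
  simp

lemma core (s lam ρ M : ℝ) (hs : 0 < s) (hl : 0 < lam) (hρ : 0 < ρ)
    (u : E3 → ℝ) (hu : Measurable u)
    (hM : (∫⁻ x, ∫⁻ y, ENNReal.ofReal ((u x - u y) ^ 2 / ‖x - y‖ ^ (3 + 2 * s)))
      ≤ ENNReal.ofReal M)
    (hyp : ∀ x, 2 * lam ≤ |u x| →
      volume ({y | lam ≤ |u y|} ∩ Metric.ball x ρ) ≤ ENNReal.ofReal (cv * ρ ^ 3 / 2)) :
    volume {x | 2 * lam ≤ |u x|} ≤ ENNReal.ofReal (2 * M * ρ ^ (2 * s) / (cv * lam ^ 2)) := by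
  have hc := cv_pos
  have hS : MeasurableSet {y | lam ≤ |u y|} := measurableSet_le measurable_const hu.abs
  have hE : MeasurableSet {y | 2 * lam ≤ |u y|} := measurableSet_le measurable_const hu.abs
  set k : ℝ := lam ^ 2 / ρ ^ (3 + 2 * s) * (cv * ρ ^ 3 / 2) with hk
  have hρs : 0 < ρ ^ (3 + 2 * s) := Real.rpow_pos_of_pos hρ _
  have hρ2 : 0 < ρ ^ (2 * s) := Real.rpow_pos_of_pos hρ _
  have hkpos : 0 < k := by positivity
  have inner : ∀ x ∈ {y | 2 * lam ≤ |u y|}, ENNReal.ofReal k ≤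
      ∫⁻ y, ENNReal.ofReal ((u x - u y) ^ 2 / ‖x - y‖ ^ (3 + 2 * s)) := by
    intro x hx
    have hx' : 2 * lam ≤ |u x| := hx
    have hvol : ENNReal.ofReal (cv * ρ ^ 3 / 2) ≤
        volume (Metric.ball x ρ \ {y | lam ≤ |u y|}) := by
      have h1 := measure_inter_add_diff (μ := volume) (Metric.ball x ρ) hS
      have h2 := hyp x hx
      rw [Set.inter_comm] at h2
      rw [vol_ball x hρ] at h1
      have h3 : ENNReal.ofReal (cv * ρ ^ 3) =
        ENNReal.ofReal (cv * ρ ^ 3 / 2) + ENNReal.ofReal (cv * ρ ^ 3 / 2) := by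
        rw [← ENNReal.ofReal_add (by positivity) (by positivity)]; congr 1; ring
      rw [h3] at h1
      by_contra hlt
      push Not at hlt
      exact absurd h1 (ENNReal.add_lt_add_of_le_of_lt
        (ne_top_of_le_ne_top ENNReal.ofReal_ne_top h2) h2 hlt).ne
    calc ENNReal.ofReal k
        = ENNReal.ofReal (lam ^ 2 / ρ ^ (3 + 2 * s)) * ENNReal.ofReal (cv * ρ ^ 3 / 2) := by
          rw [hk, ENNReal.ofReal_mul (by positivity)]
      _ ≤ ENNReal.ofReal (lam ^ 2 / ρ ^ (3 + 2 * s)) *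
            volume (Metric.ball x ρ \ {y | lam ≤ |u y|}) := by gcongr
      _ = ∫⁻ y in Metric.ball x ρ \ {y | lam ≤ |u y|},
            ENNReal.ofReal (lam ^ 2 / ρ ^ (3 + 2 * s)) := by
          rw [setLIntegral_const]
      _ ≤ ∫⁻ y in Metric.ball x ρ \ {y | lam ≤ |u y|},
            ENNReal.ofReal ((u x - u y) ^ 2 / ‖x - y‖ ^ (3 + 2 * s)) := by
          refine setLIntegral_mono' (measurableSet_ball.diff hS) ?_
          rintro y ⟨hy1, hy2⟩
          have hy2' : |u y| < lam := not_le.mp hy2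
          have hd : lam ≤ |u x - u y| := by
            have := abs_sub_abs_le_abs_sub (u x) (u y)
            linarith
          have hne : 0 < ‖x - y‖ := by
            rw [norm_pos_iff, sub_ne_zero]
            rintro rfl
            linarith
          have hlt : ‖x - y‖ ≤ ρ := by
            rw [Metric.mem_ball, dist_comm, dist_eq_norm] at hy1
            exact hy1.le
          apply ENNReal.ofReal_le_ofReal
          have h2 : lam ^ 2 ≤ (u x - u y) ^ 2 := by
            rw [← sq_abs (u x - u y)]; gcongr
          have h3 : 0 < ‖x - y‖ ^ (3 + 2 * s) := Real.rpow_pos_of_pos hne _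
          have h4 : ‖x - y‖ ^ (3 + 2 * s) ≤ ρ ^ (3 + 2 * s) :=
            Real.rpow_le_rpow hne.le hlt (by linarith)
          gcongr
      _ ≤ _ := setLIntegral_le_lintegral _ _
  have main : ENNReal.ofReal k * volume {x | 2 * lam ≤ |u x|} ≤ ENNReal.ofReal M := by
    rw [← setLIntegral_const]
    exact ((setLIntegral_mono' hE inner).trans (setLIntegral_le_lintegral _ _)).trans hM
  have hdiv : volume {x | 2 * lam ≤ |u x|} ≤ ENNReal.ofReal M / ENNReal.ofReal k := by
    rw [ENNReal.le_div_iff_mul_le (Or.inl (by simpa using hkpos)) (Or.inl ENNReal.ofReal_ne_top)]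
    rwa [mul_comm]
  refine hdiv.trans ?_
  rw [← ENNReal.ofReal_div_of_pos hkpos]
  apply le_of_eq
  congr 1
  rw [hk, Real.rpow_add hρ, show (ρ ^ (3 : ℝ)) = ρ ^ 3 by norm_cast]
  field_simp

lemma cheb (u : E3 → ℝ) (hu : Measurable u) (q t : ℝ) (hq : 0 ≤ q) (ht : 0 < t) (μ : Measure E3) :
    ENNReal.ofReal (t ^ q) * μ {x | t ≤ |u x|} ≤ ∫⁻ x, ENNReal.ofReal (|u x| ^ q) ∂μ := by
  have hE : MeasurableSet {y | t ≤ |u y|} := measurableSet_le measurable_const hu.abs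
  rw [← setLIntegral_const]
  refine (setLIntegral_mono' hE ?_).trans (setLIntegral_le_lintegral _ _)
  intro x hx
  exact ENNReal.ofReal_le_ofReal (Real.rpow_le_rpow ht.le hx hq)

/-- uniform weak-type bound at the critical exponent -/
lemma weak (s M p : ℝ) (hs : s ∈ Set.Ioo (0 : ℝ) 1) (hp : p = 6 / (3 - 2 * s)) (hM0 : 0 ≤ M) :
    ∃ K : ℝ, 0 < K ∧ ∀ u : E3 → ℝ, Measurable u →
      (∫⁻ x, ENNReal.ofReal ((u x) ^ 2)) ≤ ENNReal.ofReal M →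
      (∫⁻ x, ∫⁻ y, ENNReal.ofReal ((u x - u y) ^ 2 / ‖x - y‖ ^ (3 + 2 * s)))
        ≤ ENNReal.ofReal M →
      ∀ k : ℕ, volume {x | (2 : ℝ) ^ k ≤ |u x|} ≤ ENNReal.ofReal (K * ((2 : ℝ) ^ (-p)) ^ k) := by
  obtain ⟨hs0, hs1⟩ := hs
  have hc := cv_pos
  have h3 : 0 < 3 - 2 * s := by linarith
  have hpp : p = 2 + 2 * s * p / 3 := by rw [hp]; field_simp; ring
  set θ : ℝ := 2 * s / 3 with hθ
  have hθ1 : 0 < 1 - θ := by rw [hθ]; linarith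
  set C0 : ℝ := (2 : ℝ) ^ p * (2 * M / cv) * (2 / cv) ^ θ with hC0
  obtain ⟨K, hK1, hKM, hKC⟩ : ∃ K : ℝ, 1 ≤ K ∧ M ≤ K ∧ C0 ≤ K ^ (1 - θ) :=
    ((eventually_ge_atTop 1).and ((eventually_ge_atTop M).and
      ((tendsto_rpow_atTop hθ1).eventually_ge_atTop C0))).exists
  have hK : 0 < K := by linarith
  have hKθ : C0 * K ^ θ ≤ K := by
    calc C0 * K ^ θ ≤ K ^ (1 - θ) * K ^ θ := by gcongr
      _ = K := by rw [← Real.rpow_add hK]; simp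
  refine ⟨K, hK, fun u hu h2 hM k => ?_⟩
  induction k with
  | zero =>
    have := cheb u hu 2 1 (by norm_num) one_pos volume
    simp only [one_pow, ENNReal.ofReal_one, one_mul, Real.rpow_two, sq_abs] at this
    simp only [pow_zero, mul_one]
    exact (this.trans h2).trans (ENNReal.ofReal_le_ofReal hKM)
  | succ k ih =>
    set A : ℝ := 2 * (K * ((2 : ℝ) ^ (-p)) ^ k) / cv with hA
    have hApos : 0 < A := by positivity
    set ρ : ℝ := A ^ (1 / 3 : ℝ) with hρd
    have hρ : 0 < ρ := Real.rpow_pos_of_pos hApos _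
    have hρ3 : ρ ^ 3 = A := by
      rw [hρd, ← Real.rpow_natCast, ← Real.rpow_mul hApos.le]; norm_num
    have hρ2s : ρ ^ (2 * s) = A ^ θ := by
      rw [hρd, ← Real.rpow_mul hApos.le, hθ]; congr 1; ring
    have := core s (2 ^ k) ρ M hs0 (by positivity) hρ u hu hM (by
      intro x _
      refine (measure_mono Set.inter_subset_left).trans (ih.trans (le_of_eq ?_))
      congr 1
      rw [hρ3, hA]; field_simp)
    rw [pow_succ']
    refine this.trans (ENNReal.ofReal_le_ofReal ?_)
    rw [hρ2s]
    have e1 : A ^ θ = (2 / cv) ^ θ * K ^ θ * ((2 : ℝ) ^ (-p * θ)) ^ k := by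
      rw [hA, show 2 * (K * ((2 : ℝ) ^ (-p)) ^ k) / cv = (2 / cv) * K * ((2 : ℝ) ^ (-p)) ^ k by ring,
        Real.mul_rpow (by positivity) (by positivity), Real.mul_rpow (by positivity) (by positivity)]
      congr 1
      rw [← Real.rpow_natCast, ← Real.rpow_natCast, ← Real.rpow_mul (by positivity),
        ← Real.rpow_mul (by positivity), ← Real.rpow_mul (by positivity)]
      congr 1; ring
    have e2 : ((2 : ℝ) ^ (-p * θ)) ^ k = (2 ^ k) ^ 2 * ((2 : ℝ) ^ (-p)) ^ k := by
      rw [← pow_mul, mul_comm k 2, pow_mul, ← mul_pow]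
      congr 1
      rw [← Real.rpow_natCast, ← Real.rpow_add (by norm_num)]
      congr 1
      rw [hθ]; push_cast; linarith
    have e3 : (2 : ℝ) ^ p * (2 : ℝ) ^ (-p) = 1 := by
      rw [← Real.rpow_add (by norm_num)]; simp
    calc 2 * M * A ^ θ / (cv * (2 ^ k) ^ 2)
        = (2 * M / cv) * (2 / cv) ^ θ * K ^ θ * ((2 : ℝ) ^ (-p)) ^ k := by
          rw [e1, e2]; field_simp
      _ = (C0 * K ^ θ) * ((2 : ℝ) ^ (-p) * ((2 : ℝ) ^ (-p)) ^ k) := by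
          rw [hC0]
          linear_combination (-(2 * M / cv) * (2 / cv) ^ θ * K ^ θ * ((2 : ℝ) ^ (-p)) ^ k) * e3
      _ ≤ K * ((2 : ℝ) ^ (-p) * ((2 : ℝ) ^ (-p)) ^ k) := by gcongr
      _ = _ := by rw [pow_succ']

/-- pointwise splitting -/
lemma split (r δ t : ℝ) (m : ℕ) (hr : 2 < r) (hδ : 0 < δ) :
    ENNReal.ofReal (|t| ^ r) ≤ ENNReal.ofReal (δ ^ (r - 2)) * ENNReal.ofReal (t ^ 2)
      + Set.indicator {t : ℝ | δ ≤ |t|} (fun _ => ENNReal.ofReal (((2 : ℝ) ^ m) ^ r)) t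
      + ∑' k : ℕ, Set.indicator {t : ℝ | (2 : ℝ) ^ (k + m) ≤ |t|}
          (fun _ => ENNReal.ofReal (((2 : ℝ) ^ (k + m + 1)) ^ r)) t := by
  by_cases h1 : |t| < δ
  · refine le_trans ?_ (le_trans le_self_add le_self_add)
    rw [← ENNReal.ofReal_mul (by positivity)]
    apply ENNReal.ofReal_le_ofReal
    rcases eq_or_ne t 0 with rfl | ht
    · simp [Real.zero_rpow (by linarith : r ≠ 0)]
    have ht' : 0 < |t| := abs_pos.mpr ht
    calc |t| ^ r = |t| ^ (r - 2) * t ^ 2 := by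
          rw [← sq_abs t, ← Real.rpow_two, ← Real.rpow_add ht']; congr 1; ring
      _ ≤ δ ^ (r - 2) * t ^ 2 := by
          gcongr
  push Not at h1
  by_cases h2 : |t| < 2 ^ m
  · refine le_trans ?_ (le_trans le_add_self le_self_add)
    rw [Set.indicator_of_mem (show t ∈ {t : ℝ | δ ≤ |t|} from h1)]
    apply ENNReal.ofReal_le_ofReal
    gcongr
  push Not at h2
  refine le_trans ?_ le_add_self
  have hm : (0 : ℝ) < 2 ^ m := by positivity
  obtain ⟨k, hk1, hk2⟩ := exists_nat_pow_near (x := |t| / 2 ^ m) (y := 2)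
    (by rwa [le_div_iff₀ hm, one_mul]) (by norm_num)
  rw [le_div_iff₀ hm, ← pow_add] at hk1
  rw [div_lt_iff₀ hm, ← pow_add] at hk2
  refine le_trans ?_ (ENNReal.le_tsum k)
  rw [Set.indicator_of_mem (show t ∈ {t : ℝ | (2 : ℝ) ^ (k + m) ≤ |t|} from hk1)]
  apply ENNReal.ofReal_le_ofReal
  rw [show k + m + 1 = k + 1 + m by ring]
  gcongr

lemma split_int (r δ : ℝ) (m : ℕ) (hr : 2 < r) (hδ : 0 < δ) (u : E3 → ℝ) (hu : Measurable u) :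
    ∫⁻ x, ENNReal.ofReal (|u x| ^ r) ≤
      ENNReal.ofReal (δ ^ (r - 2)) * (∫⁻ x, ENNReal.ofReal ((u x) ^ 2))
      + ENNReal.ofReal (((2 : ℝ) ^ m) ^ r) * volume {x | δ ≤ |u x|}
      + ∑' k : ℕ, ENNReal.ofReal (((2 : ℝ) ^ (k + m + 1)) ^ r) *
          volume {x | (2 : ℝ) ^ (k + m) ≤ |u x|} := by
  have hE : ∀ t : ℝ, MeasurableSet {y | t ≤ |u y|} :=
    fun t => measurableSet_le measurable_const hu.abs
  refine (lintegral_mono fun x => split r δ (u x) m hr hδ).trans (le_of_eq ?_)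
  have key : ∀ (t : ℝ) (c : ℝ≥0∞), (fun x => Set.indicator {t' : ℝ | t ≤ |t'|} (fun _ => c) (u x))
      = Set.indicator {x | t ≤ |u x|} (fun _ => c) := fun t c => rfl
  have hmE : ∀ (t : ℝ) (c : ℝ≥0∞),
      Measurable (fun x => Set.indicator {t' : ℝ | t ≤ |t'|} (fun _ => c) (u x)) := by
    intro t c
    rw [key]
    exact measurable_const.indicator (hE t)
  have hT := Measurable.ennreal_tsum (fun k : ℕ => hmE (2 ^ (k + m))
    (ENNReal.ofReal (((2 : ℝ) ^ (k + m + 1)) ^ r)))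
  rw [lintegral_add_right _ hT, lintegral_add_right _ (hmE _ _),
    lintegral_const_mul _ (by fun_prop), lintegral_tsum (fun k => (hmE _ _).aemeasurable), key,
    lintegral_indicator_const (hE _)]
  congr 2
  funext k
  rw [key, lintegral_indicator_const (hE _)]

end VanishingAux


/-- Vanishing (Lions-type) lemma: if `(u_n)` is bounded in `H^s(ℝ³, ℝ)` and
`sup_y ∫_{B_R(y)} |u_n|^q → 0` for some `q ∈ [2, 2*_s)` and `R > 0`, then
`u_n → 0` in `L^r(ℝ³, ℝ)` for all `r ∈ (2, 2*_s)`. -/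
theorem vanishing_lemma
    (s q R : ℝ) (hs : s ∈ Set.Ioo (0 : ℝ) 1)
    (hq : q ∈ Set.Ico (2 : ℝ) (6 / (3 - 2 * s))) (hR : 0 < R)
    (u : ℕ → EuclideanSpace ℝ (Fin 3) → ℝ)
    (hmeas : ∀ n, Measurable (u n))
    (hbdd : ∃ M : ℝ≥0∞, M ≠ ⊤ ∧ ∀ n,
      (∫⁻ x, ENNReal.ofReal ((u n x) ^ 2)) +
        (∫⁻ x, ∫⁻ y,
          ENNReal.ofReal ((u n x - u n y) ^ 2 / ‖x - y‖ ^ (3 + 2 * s))) ≤ M)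
    (hvan : Tendsto
      (fun n => ⨆ y : EuclideanSpace ℝ (Fin 3),
        ∫⁻ x in Metric.ball y R, ENNReal.ofReal (|u n x| ^ q))
      atTop (nhds 0)) :
    ∀ r ∈ Set.Ioo (2 : ℝ) (6 / (3 - 2 * s)),
      Tendsto (fun n => ∫⁻ x, ENNReal.ofReal (|u n x| ^ r)) atTop (nhds 0) := by
  intro r hr
  obtain ⟨M', hM'top, hM'⟩ := hbdd
  obtain ⟨M, hM0, rfl⟩ : ∃ M : ℝ, 0 ≤ M ∧ M' = ENNReal.ofReal M :=
    ⟨M'.toReal, ENNReal.toReal_nonneg, (ENNReal.ofReal_toReal hM'top).symm⟩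
  have hA := fun n => le_self_add.trans (hM' n)
  have hB := fun n => le_add_self.trans (hM' n)
  have hc := VanishingAux.cv_pos
  -- convergence in measure
  have hmeasure : ∀ δ : ℝ, 0 < δ →
      Tendsto (fun n => volume {x | δ ≤ |u n x|}) atTop (nhds 0) := by
    intro δ hδ
    rw [ENNReal.tendsto_nhds_zero]
    intro ε hε
    have hlim : Tendsto (fun ρ : ℝ => ENNReal.ofReal
        (2 * M * ρ ^ (2 * s) / (VanishingAux.cv * (δ / 2) ^ 2))) (nhdsWithin 0 (Set.Ioi 0))
        (nhds 0) := by
      have h1 : Tendsto (fun ρ : ℝ => ρ ^ (2 * s)) (nhdsWithin 0 (Set.Ioi 0)) (nhds 0) := by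
        have := (Real.continuousAt_rpow_const 0 (2 * s) (Or.inr (by linarith [hs.1]))).tendsto
        rw [Real.zero_rpow (by linarith [hs.1])] at this
        exact this.mono_left nhdsWithin_le_nhds
      have h2 := ENNReal.tendsto_ofReal
        ((h1.const_mul (2 * M)).div_const (VanishingAux.cv * (δ / 2) ^ 2))
      simpa using h2
    obtain ⟨ρ, hρε, hρR, hρ0⟩ := ((ENNReal.tendsto_nhds_zero.mp hlim ε hε).and
      ((eventually_nhdsWithin_of_eventually_nhds (eventually_le_nhds hR)).and
        self_mem_nhdsWithin)).exists
    have hρ : 0 < ρ := hρ0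
    have hδq : 0 < (δ / 2) ^ q := Real.rpow_pos_of_pos (by positivity) _
    have hev := ENNReal.tendsto_nhds_zero.mp hvan
      (ENNReal.ofReal ((δ / 2) ^ q * (VanishingAux.cv * ρ ^ 3 / 2)))
      (by rw [gt_iff_lt, ENNReal.ofReal_pos]; positivity)
    filter_upwards [hev] with n hn
    have := VanishingAux.core s (δ / 2) ρ M hs.1 (by positivity) hρ (u n) (hmeas n) (hB n) (by
      intro x _
      have h1 := VanishingAux.cheb (u n) (hmeas n) q (δ / 2) (by linarith [hq.1]) (by positivity)
        (volume.restrict (Metric.ball x R))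
      have h2 := h1.trans ((le_iSup (fun y => ∫⁻ x in Metric.ball y R,
        ENNReal.ofReal (|u n x| ^ q)) x).trans hn)
      rw [Measure.restrict_apply (measurableSet_le measurable_const (hmeas n).abs),
        ENNReal.ofReal_mul hδq.le,
        ENNReal.mul_le_mul_iff_right (by simpa using hδq) ENNReal.ofReal_ne_top] at h2
      exact (measure_mono (Set.inter_subset_inter_right _ (Metric.ball_subset_ball hρR))).trans h2)
    rw [mul_div_cancel₀ _ (two_ne_zero)] at this
    exact this.trans hρε
  obtain ⟨K, hK, hweak⟩ := VanishingAux.weak s M _ hs rfl hM0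
  set p : ℝ := 6 / (3 - 2 * s) with hp
  set f : ℕ → ℝ≥0∞ := fun k => ENNReal.ofReal (((2 : ℝ) ^ (k + 1)) ^ r) *
    ENNReal.ofReal (K * ((2 : ℝ) ^ (-p)) ^ k) with hf
  have hsum : ∑' k, f k ≠ ⊤ := by
    have hfe : f = fun k => ENNReal.ofReal ((2 ^ r * K) * ((2 : ℝ) ^ (r - p)) ^ k) := by
      funext k
      rw [hf]
      simp only
      rw [← ENNReal.ofReal_mul (by positivity)]
      congr 1
      rw [pow_succ, Real.mul_rpow (by positivity) (by positivity), sub_eq_add_neg,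
        Real.rpow_add (by norm_num), mul_pow, ← Real.rpow_natCast, ← Real.rpow_natCast (2 ^ r),
        ← Real.rpow_mul (by norm_num), ← Real.rpow_mul (by norm_num), mul_comm r]
      ring
    rw [hfe]
    exact ((summable_geometric_of_lt_one (by positivity)
      (Real.rpow_lt_one_of_one_lt_of_neg (by norm_num) (by linarith [hr.2]))).mul_left
        _).tsum_ofReal_ne_top
  have htail := ENNReal.tendsto_sum_nat_add f hsum
  rw [ENNReal.tendsto_nhds_zero]
  intro ε hε
  have hε3 : 0 < ε / 3 := ENNReal.div_pos hε.ne' (by simp)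
  obtain ⟨m, hm⟩ := (ENNReal.tendsto_nhds_zero.mp htail (ε / 3) hε3).exists
  have hlim : Tendsto (fun δ : ℝ => ENNReal.ofReal (δ ^ (r - 2)) * ENNReal.ofReal M)
      (nhdsWithin 0 (Set.Ioi 0)) (nhds 0) := by
    have h1 : Tendsto (fun δ : ℝ => δ ^ (r - 2)) (nhdsWithin 0 (Set.Ioi 0)) (nhds 0) := by
      have := (Real.continuousAt_rpow_const 0 (r - 2) (Or.inr (by linarith [hr.1]))).tendsto
      rw [Real.zero_rpow (by linarith [hr.1])] at this
      exact this.mono_left nhdsWithin_le_nhds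
    have h2 := ENNReal.Tendsto.mul_const (b := ENNReal.ofReal M) (ENNReal.tendsto_ofReal h1)
      (Or.inr ENNReal.ofReal_ne_top)
    simpa using h2
  obtain ⟨δ, hδε, hδ0⟩ := ((ENNReal.tendsto_nhds_zero.mp hlim _ hε3).and
    self_mem_nhdsWithin).exists
  have hδ : 0 < δ := hδ0
  have hmid := ENNReal.Tendsto.const_mul (a := ENNReal.ofReal (((2 : ℝ) ^ m) ^ r)) (hmeasure δ hδ)
    (Or.inr ENNReal.ofReal_ne_top)
  rw [mul_zero] at hmid
  filter_upwards [ENNReal.tendsto_nhds_zero.mp hmid _ hε3] with n hn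
  refine (VanishingAux.split_int r δ m hr.1 hδ (u n) (hmeas n)).trans ?_
  rw [← ENNReal.add_thirds ε]
  refine add_le_add (add_le_add ?_ hn) ?_
  · refine le_trans ?_ hδε
    gcongr
    exact hA n
  · refine le_trans ?_ hm
    refine ENNReal.tsum_le_tsum fun k => ?_
    simp only [hf]
    gcongr
    exact hweak (u n) (hmeas n) (hA n) (hB n) (k + m)
end
end

section
/- Let t ∈ (0,1). There exists a constant C > 0, depending only on t, such that for every measurable u : ℝ³ → ℝ, defining φ_u(x) = ∫_{ℝ³} u(y)²/|x−y|^{3−2t} dy, one has ∬_{ℝ³×ℝ³} (φ_u(x) − φ_u(y))²/|x−y|^{3+2t} dx dy ≤ C ( ∫_{ℝ³} |u(x)|^{12/(3+2t)} dx )^{(3+2t)/3} (as an inequality in [0,∞]). -/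
open MeasureTheory

noncomputable section

abbrev E3 := EuclideanSpace ℝ (Fin 3)

/-- power kernel -/
def PK (a : ℝ) (x : E3) : ENNReal := ENNReal.ofReal (‖x‖ ^ (-a))

lemma PK_meas (a : ℝ) : Measurable (PK a) := by
  unfold PK; fun_prop

lemma PK_neg (a : ℝ) (x : E3) : PK a (-x) = PK a x := by simp [PK]

lemma PK_symm (a : ℝ) (x y : E3) : PK a (x - y) = PK a (y - x) := by
  rw [← PK_neg, neg_sub]

lemma lint_scale (F : E3 → ENNReal) (hF : Measurable F) (r : ℝ) (hr : 0 < r) :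
    ∫⁻ h, F h = ENNReal.ofReal (r ^ 3) * ∫⁻ h, F (r • h) := by
  have h1 := Measure.map_addHaar_smul (volume : Measure E3) hr.ne'
  have h2 : ∫⁻ h, F (r • h) = ∫⁻ h, F h ∂(Measure.map (r • ·) (volume : Measure E3)) := by
    rw [lintegral_map hF (by fun_prop)]
  rw [h2, h1, lintegral_smul_measure, smul_eq_mul, ← mul_assoc, ← ENNReal.ofReal_mul (by positivity)]
  have : r ^ 3 * |(r ^ Module.finrank ℝ E3)⁻¹| = 1 := by
    rw [finrank_euclideanSpace_fin, abs_of_pos (by positivity)]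
    field_simp
  rw [this]; simp

lemma near_one (a : ℝ) (ha : a < 3) : ∫⁻ h in Metric.ball (0 : E3) 1, PK a h < ⊤ := by
  have h : IntegrableOn (fun x : E3 => ‖x‖ ^ (-a)) (Metric.ball 0 1) volume := by
    rw [integrableOn_fun_norm_addHaar volume (f := fun y => y ^ (-a))]
    rw [finrank_euclideanSpace_fin]
    have : IntegrableOn (fun y : ℝ => y ^ (2 - a)) (Set.Ioo 0 1) := by
      rw [intervalIntegral.integrableOn_Ioo_rpow_iff (by norm_num)]; linarith
    refine this.congr_fun ?_ measurableSet_Ioo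
    intro y hy
    simp only [smul_eq_mul]
    rw [sub_eq_add_neg, Real.rpow_add hy.1]; norm_num
  have := h.2
  rw [hasFiniteIntegral_iff_norm] at this
  refine lt_of_eq_of_lt ?_ this
  refine lintegral_congr fun x => ?_
  rw [PK, Real.norm_of_nonneg (by positivity)]

lemma far_one (a : ℝ) (ha : 3 < a) : ∫⁻ h in (Metric.ball (0 : E3) 1)ᶜ, PK a h < ⊤ := by
  have h : Integrable (fun x : E3 => (1 + ‖x‖) ^ (-a)) volume := by
    apply integrable_one_add_norm
    rw [finrank_euclideanSpace_fin]; exact_mod_cast ha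
  have h := (h.const_mul ((2:ℝ) ^ a)).2
  rw [hasFiniteIntegral_iff_norm] at h
  refine lt_of_le_of_lt ?_ h
  refine le_trans ?_ (setLIntegral_le_lintegral (Metric.ball (0 : E3) 1)ᶜ _)
  refine setLIntegral_mono (by fun_prop) fun x hx => ?_
  rw [PK]
  refine ENNReal.ofReal_le_ofReal ?_
  have hx : 1 ≤ ‖x‖ := by simpa using hx
  rw [Real.norm_of_nonneg (by positivity)]
  have : (2:ℝ) ^ a = (1/2) ^ (-a) := by
    rw [Real.rpow_neg (by norm_num), ← Real.inv_rpow (by norm_num)]; norm_num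
  rw [this, ← Real.mul_rpow (by norm_num) (by positivity)]
  exact Real.rpow_le_rpow_of_nonpos (by positivity) (by linarith) (by linarith)

lemma PK_smul (a : ℝ) (r : ℝ) (hr : 0 < r) (x : E3) :
    PK a (r • x) = ENNReal.ofReal (r ^ (-a)) * PK a x := by
  rw [PK, PK, norm_smul, Real.norm_of_nonneg hr.le, Real.mul_rpow hr.le (norm_nonneg _),
    ENNReal.ofReal_mul (by positivity)]

lemma set_scale (a : ℝ) (r : ℝ) (hr : 0 < r) (s s' : Set E3) (hs : MeasurableSet s)
    (hs' : MeasurableSet s') (h : ∀ x, r • x ∈ s' ↔ x ∈ s) :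
    ∫⁻ h in s', PK a h = (∫⁻ h in s, PK a h) * ENNReal.ofReal (r ^ (3 - a)) := by
  rw [← lintegral_indicator hs', ← lintegral_indicator hs,
    lint_scale _ ((PK_meas a).indicator hs') r hr]
  have : ∀ x, s'.indicator (PK a) (r • x) = ENNReal.ofReal (r ^ (-a)) * s.indicator (PK a) x := by
    intro x
    by_cases hx : x ∈ s
    · simp [hx, (h x).2 hx, PK_smul a r hr]
    · simp [hx, mt (h x).1 hx]
  simp_rw [this]
  rw [lintegral_const_mul _ ((PK_meas a).indicator hs), ← mul_assoc,
    ← ENNReal.ofReal_mul (by positivity), mul_comm]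
  congr 2
  rw [sub_eq_add_neg, Real.rpow_add hr]; norm_cast

lemma near (a : ℝ) (ha : a < 3) : ∃ C : ℝ, 0 < C ∧ ∀ r : ℝ, 0 < r →
    ∫⁻ h in Metric.ball (0 : E3) r, PK a h ≤ ENNReal.ofReal (C * r ^ (3 - a)) := by
  refine ⟨(∫⁻ h in Metric.ball (0 : E3) 1, PK a h).toReal + 1, by positivity, fun r hr => ?_⟩
  rw [set_scale a r hr (Metric.ball (0 : E3) 1) _ measurableSet_ball measurableSet_ball,
    ENNReal.ofReal_mul (by positivity)]
  · gcongr
    rw [ENNReal.ofReal_add (by positivity) (by positivity), ENNReal.ofReal_toReal (near_one a ha).ne]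
    exact le_self_add
  · intro x
    simp [norm_smul, abs_of_pos hr, hr]

lemma far (a : ℝ) (ha : 3 < a) : ∃ C : ℝ, 0 < C ∧ ∀ r : ℝ, 0 < r →
    ∫⁻ h in (Metric.ball (0 : E3) r)ᶜ, PK a h ≤ ENNReal.ofReal (C * r ^ (3 - a)) := by
  refine ⟨(∫⁻ h in (Metric.ball (0 : E3) 1)ᶜ, PK a h).toReal + 1, by positivity, fun r hr => ?_⟩
  rw [set_scale a r hr (Metric.ball (0 : E3) 1)ᶜ _ measurableSet_ball.compl measurableSet_ball.compl,
    ENNReal.ofReal_mul (by positivity)]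
  · gcongr
    rw [ENNReal.ofReal_add (by positivity) (by positivity), ENNReal.ofReal_toReal (far_one a ha).ne]
    exact le_self_add
  · intro x
    simp [norm_smul, abs_of_pos hr, hr]

lemma cs (F q : E3 → ENNReal) (hF : Measurable F) (hq : Measurable q) :
    (∫⁻ z, F z * q z) ^ 2 ≤ (∫⁻ z, F z) * ∫⁻ z, F z * q z ^ 2 := by
  have h := ENNReal.lintegral_mul_le_Lp_mul_Lq (volume : Measure E3) Real.HolderConjugate.two_two
    (f := fun z => F z ^ (1/2 : ℝ)) (g := fun z => F z ^ (1/2 : ℝ) * q z)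
    (by fun_prop) (by fun_prop)
  have e1 : ∀ x : ENNReal, x ^ (1/2:ℝ) * x ^ (1/2:ℝ) = x := by
    intro x
    rw [← ENNReal.rpow_add_of_nonneg _ _ (by norm_num) (by norm_num)]; norm_num
  have e2 : ∀ x : ENNReal, (x ^ (1/2:ℝ)) ^ (2:ℝ) = x := by
    intro x; rw [← ENNReal.rpow_mul]; norm_num
  simp only [Pi.mul_apply, ← mul_assoc, e1, ENNReal.mul_rpow_of_nonneg _ _ (zero_le_two), e2] at h
  have h2 := pow_le_pow_left' h 2
  rw [mul_pow] at h2
  have e3 : ∀ x : ENNReal, (x ^ (1/2:ℝ)) ^ 2 = x := by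
    intro x; rw [sq, e1]
  rw [e3, e3] at h2
  simpa using h2


lemma PK_mul (a b : ℝ) (x : E3) (hx : x ≠ 0) : PK a x * PK b x = PK (a + b) x := by
  rw [PK, PK, PK, ← ENNReal.ofReal_mul (by positivity), ← Real.rpow_add (norm_pos_iff.2 hx)]
  congr 2; ring

lemma comp_aux (s d : ℝ) (hs : 0 < s) (hd : 0 < d) (a b : E3) (hab : ‖a‖ ≤ ‖b‖) (hd2 : d ≤ ‖a‖ + ‖b‖) :
    PK s a * PK s b ≤ (Metric.ball (0:E3) d).indicator
      (fun h => ENNReal.ofReal ((d/2)^(-s)) * PK s h) a +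
      ((Metric.ball (0:E3) d)ᶜ).indicator (PK (2*s)) a := by
  by_cases ha : a ∈ Metric.ball (0:E3) d
  · simp only [ha, Set.indicator_of_mem, Set.mem_compl_iff, not_true_eq_false, not_false_eq_true,
      Set.indicator_of_notMem, add_zero]
    rw [mul_comm]
    gcongr
    rw [PK]
    apply ENNReal.ofReal_le_ofReal
    exact Real.rpow_le_rpow_of_nonpos (by positivity) (by linarith) (by linarith)
  · simp only [ha, Set.indicator_of_mem, Set.mem_compl_iff, not_false_eq_true,
      Set.indicator_of_notMem, zero_add]
    have ha' : d ≤ ‖a‖ := by simpa using ha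
    have h0 : a ≠ 0 := norm_pos_iff.1 (by linarith)
    rw [two_mul, ← PK_mul _ _ _ h0]
    gcongr
    rw [PK, PK]
    apply ENNReal.ofReal_le_ofReal
    exact Real.rpow_le_rpow_of_nonpos (by linarith) (by linarith) (by linarith)

lemma comp (s : ℝ) (hs : 3/2 < s) (hs3 : s < 3) : ∃ C : ℝ, 0 < C ∧ ∀ z w : E3, z ≠ w →
    ∫⁻ x, PK s (x - z) * PK s (x - w) ≤ ENNReal.ofReal C * PK (2*s-3) (z - w) := by
  obtain ⟨C1, hC1, h1⟩ := near s hs3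
  obtain ⟨C2, hC2, h2⟩ := far (2*s) (by linarith)
  refine ⟨2 * (2^s * C1 + C2), by positivity, fun z w hzw => ?_⟩
  set d := ‖z - w‖ with hd
  have hd0 : 0 < d := norm_pos_iff.2 (sub_ne_zero.2 hzw)
  set T : E3 → ENNReal := fun a => (Metric.ball (0:E3) d).indicator
      (fun h => ENNReal.ofReal ((d/2)^(-s)) * PK s h) a +
      ((Metric.ball (0:E3) d)ᶜ).indicator (PK (2*s)) a with hT
  have m1 : Measurable (fun h : E3 => ENNReal.ofReal ((d/2)^(-s)) * PK s h) :=
    (PK_meas s).const_mul _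
  have hTm : Measurable T := by
    exact (m1.indicator measurableSet_ball).add ((PK_meas _).indicator measurableSet_ball.compl)
  have hb : ∀ x, PK s (x - z) * PK s (x - w) ≤ T (x - z) + T (x - w) := by
    intro x
    have hd2 : d ≤ ‖x - z‖ + ‖x - w‖ := by
      have : z - w = (x - w) - (x - z) := by abel
      rw [hd, this]
      linarith [norm_sub_le (x - w) (x - z)]
    rcases le_total ‖x - z‖ ‖x - w‖ with h | h
    · exact (comp_aux s d (by linarith) hd0 _ _ h hd2).trans le_self_add
    · rw [mul_comm]
      exact (comp_aux s d (by linarith) hd0 _ _ h (by linarith)).trans le_add_self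
  have hI : ∫⁻ x, T x ≤ ENNReal.ofReal ((2^s * C1 + C2) * d ^ (-(2*s-3))) := by
    rw [hT, lintegral_add_left (m1.indicator measurableSet_ball),
      lintegral_indicator measurableSet_ball, lintegral_indicator measurableSet_ball.compl,
      lintegral_const_mul _ (PK_meas s)]
    calc _ ≤ ENNReal.ofReal ((d/2)^(-s)) * ENNReal.ofReal (C1 * d ^ (3 - s))
            + ENNReal.ofReal (C2 * d ^ (3 - 2*s)) := by
          gcongr
          · exact h1 d hd0
          · exact h2 d hd0
      _ = _ := by
          rw [← ENNReal.ofReal_mul (by positivity), ← ENNReal.ofReal_add (by positivity) (by positivity)]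
          congr 1
          have e1 : (d/2)^(-s) = d^(-s) * 2^s := by
            rw [Real.div_rpow hd0.le (by norm_num), Real.rpow_neg (by norm_num : (0:ℝ) ≤ 2)]
            field_simp
          have e2 : d ^ (-(2*s-3)) = d^(-s) * d^(3-s) := by
            rw [← Real.rpow_add hd0]; congr 1; ring
          have e3 : d ^ (3-2*s) = d^(-s) * d^(3-s) := by
            rw [← Real.rpow_add hd0]; congr 1; ring
          rw [e1, e2, e3]; ring
  calc _ ≤ ∫⁻ x, (T (x - z) + T (x - w)) := lintegral_mono hb
    _ = (∫⁻ x, T x) + ∫⁻ x, T x := by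
        rw [lintegral_add_left (by fun_prop), lintegral_sub_right_eq_self, lintegral_sub_right_eq_self]
    _ ≤ _ := by
        rw [PK, ← ENNReal.ofReal_mul (by positivity), ← two_mul]
        refine (mul_le_mul_right hI 2).trans ?_
        rw [mul_assoc, ENNReal.ofReal_mul (p := 2) (by norm_num), ENNReal.ofReal_ofNat]

lemma q_lemma (t : ℝ) (ht : 0 < t) (ht1 : t < 1) : ∃ C : ℝ, 0 < C ∧ ∀ r : ℝ, 0 < r → ∀ x : E3,
    ∫⁻ y, ENNReal.ofReal (r ^ t * min 1 (3 * ‖x - y‖ / r)) ^ 2 * PK (3 + 2*t) (x - y) ≤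
      ENNReal.ofReal C := by
  obtain ⟨C1, hC1, h1⟩ := near (1 + 2*t) (by linarith)
  obtain ⟨C2, hC2, h2⟩ := far (3 + 2*t) (by linarith)
  refine ⟨9 * C1 + C2, by positivity, fun r hr x => ?_⟩
  rw [lintegral_sub_left_eq_self
    (fun h => ENNReal.ofReal (r ^ t * min 1 (3 * ‖h‖ / r)) ^ 2 * PK (3 + 2*t) h) x]
  have m1 : Measurable (fun h : E3 => ENNReal.ofReal (9 * r^(2*t-2)) * PK (1+2*t) h) :=
    (PK_meas _).const_mul _
  have m2 : Measurable (fun h : E3 => ENNReal.ofReal (r^(2*t)) * PK (3+2*t) h) :=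
    (PK_meas _).const_mul _
  calc _ ≤ ∫⁻ h, ((Metric.ball (0:E3) r).indicator
      (fun h => ENNReal.ofReal (9 * r^(2*t-2)) * PK (1+2*t) h) h +
      ((Metric.ball (0:E3) r)ᶜ).indicator (fun h => ENNReal.ofReal (r^(2*t)) * PK (3+2*t) h) h) := by
        refine lintegral_mono fun h => ?_
        have hrt : r ^ (2*t) = (r^t)^2 := by rw [mul_comm, Real.rpow_mul hr.le]; norm_cast
        by_cases hh : h ∈ Metric.ball (0:E3) r
        · simp only [hh, Set.indicator_of_mem, Set.mem_compl_iff, not_true_eq_false,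
            not_false_eq_true, Set.indicator_of_notMem, add_zero]
          rw [PK, PK, ← ENNReal.ofReal_pow (by positivity), ← ENNReal.ofReal_mul (by positivity),
            ← ENNReal.ofReal_mul (by positivity)]
          apply ENNReal.ofReal_le_ofReal
          rcases eq_or_ne h 0 with h0 | h0
          · subst h0
            simp only [norm_zero, mul_zero, zero_div, zero_le_one, min_eq_right]
            have : 0 ≤ 9 * r ^ (2 * t - 2) * (0:ℝ) ^ (-(1 + 2 * t)) := by positivity
            simpa using this
          have hp := norm_pos_iff.2 h0
          have e1 : ‖h‖ ^ (-(1+2*t)) = ‖h‖^2 * ‖h‖ ^ (-(3+2*t)) := by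
            rw [← Real.rpow_natCast, ← Real.rpow_add hp]; congr 1; push_cast; ring
          have e2 : r ^ (2*t-2) = (r^t)^2 / r^2 := by
            rw [Real.rpow_sub hr, hrt]; norm_cast
          calc _ ≤ (r^t * (3 * ‖h‖ / r))^2 * ‖h‖ ^ (-(3+2*t)) := by
                gcongr
                exact min_le_right _ _
            _ = _ := by rw [e1, e2]; field_simp; ring
        · simp only [hh, Set.indicator_of_mem, Set.mem_compl_iff, not_false_eq_true,
            Set.indicator_of_notMem, zero_add]
          gcongr
          rw [← ENNReal.ofReal_pow (by positivity)]
          apply ENNReal.ofReal_le_ofReal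
          rw [hrt]
          gcongr
          have := min_le_left 1 (3 * ‖h‖ / r)
          nlinarith [Real.rpow_pos_of_pos hr t]
    _ ≤ ENNReal.ofReal (9 * r^(2*t-2)) * ENNReal.ofReal (C1 * r ^ (3 - (1+2*t)))
            + ENNReal.ofReal (r^(2*t)) * ENNReal.ofReal (C2 * r ^ (3 - (3 + 2*t))) := by
        rw [lintegral_add_left (m1.indicator measurableSet_ball),
          lintegral_indicator measurableSet_ball, lintegral_indicator measurableSet_ball.compl,
          lintegral_const_mul _ (PK_meas _), lintegral_const_mul _ (PK_meas _)]
        gcongr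
        · exact h1 r hr
        · exact h2 r hr
    _ = _ := by
        rw [← ENNReal.ofReal_mul (by positivity), ← ENNReal.ofReal_mul (by positivity),
          ← ENNReal.ofReal_add (by positivity) (by positivity)]
        congr 1
        have e1 : r^(2*t-2) * r ^ (3 - (1+2*t)) = 1 := by
          rw [← Real.rpow_add hr]; ring_nf; simp
        have e2 : r^(2*t) * r ^ (3 - (3+2*t)) = 1 := by
          rw [← Real.rpow_add hr]; ring_nf; simp
        linear_combination 9 * C1 * e1 + C2 * e2


lemma PK_rpow (a c : ℝ) (hc : 0 ≤ c) (x : E3) : PK a x ^ c = PK (a * c) x := by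
  rw [PK, PK, ENNReal.ofReal_rpow_of_nonneg (by positivity) hc, ← Real.rpow_mul (norm_nonneg _)]
  congr 2; ring

lemma hls_inner (t : ℝ) (ht : 0 < t) (ht1 : t < 1) : ∃ C : ℝ, 0 < C ∧
    ∀ f : E3 → ℝ, Measurable f → (∀ x, 0 ≤ f x) → ∀ N : ℝ, 0 < N →
    ∫⁻ x, ENNReal.ofReal (f x ^ (6 / (3 + 2*t))) = ENNReal.ofReal N → ∀ z b, 0 < b →
    ∫⁻ w, {w | f w ≤ b}.indicator (fun w => ENNReal.ofReal (f w) * PK (3 - 2*t) (z - w)) w ≤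
      ENNReal.ofReal (C * N ^ (2*t/3) * b ^ (6 / (3 + 2*t) - 1)) := by
  obtain ⟨C1, hC1, h1⟩ := near (3 - 2*t) (by linarith)
  obtain ⟨C2, hC2, h2⟩ := far 6 (by norm_num)
  refine ⟨C1 + C2 ^ ((3-2*t)/6), by positivity, fun f hf hf0 N hN hfN z b hb => ?_⟩
  set R : ℝ := N ^ (1/3 : ℝ) * b ^ (-(2 / (3 + 2*t))) with hR
  have hR0 : 0 < R := by positivity
  have hlam : 0 < 3 - 2*t := by linarith
  have m1 : Measurable (fun h : E3 => ENNReal.ofReal b * PK (3-2*t) h) :=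
    (PK_meas _).const_mul _
  have m2 := (PK_meas (3-2*t)).indicator (measurableSet_ball (x := (0:E3)) (ε := R)).compl
  have hp : (6 / (3+2*t)).HolderConjugate (6 / (3 - 2*t)) := by
    rw [Real.holderConjugate_iff]
    refine ⟨by rw [lt_div_iff₀ (by linarith)]; linarith, ?_⟩
    field_simp; ring
  calc _ ≤ ∫⁻ w, ((Metric.ball (0:E3) R).indicator (fun h => ENNReal.ofReal b * PK (3-2*t) h) (z - w)
        + ENNReal.ofReal (f w) * (Metric.ball (0:E3) R)ᶜ.indicator (PK (3-2*t)) (z - w)) := by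
        refine lintegral_mono fun w => ?_
        by_cases hw : f w ≤ b
        · rw [Set.indicator_of_mem (by exact hw)]
          by_cases hh : z - w ∈ Metric.ball (0:E3) R
          · rw [Set.indicator_of_mem hh, Set.indicator_of_notMem (by simpa using hh)]
            simp only [mul_zero, add_zero]
            gcongr
          · rw [Set.indicator_of_notMem hh, Set.indicator_of_mem (by simpa using hh)]
            simp
        · rw [Set.indicator_of_notMem (by exact hw)]; exact zero_le
    _ = (∫⁻ h in Metric.ball (0:E3) R, ENNReal.ofReal b * PK (3-2*t) h) +
        ∫⁻ w, ENNReal.ofReal (f w) * (Metric.ball (0:E3) R)ᶜ.indicator (PK (3-2*t)) (z - w) := by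
        have m3 : Measurable (fun w => (Metric.ball (0:E3) R).indicator
            (fun h => ENNReal.ofReal b * PK (3-2*t) h) (z - w)) :=
          (m1.indicator measurableSet_ball).comp (measurable_const.sub measurable_id)
        rw [lintegral_add_left m3,
          lintegral_sub_left_eq_self _ z, lintegral_indicator measurableSet_ball]
    _ ≤ ENNReal.ofReal (b * (C1 * R ^ (3 - (3 - 2*t)))) +
        ENNReal.ofReal (N ^ ((3+2*t)/6) * (C2 * R ^ (3 - 6 : ℝ)) ^ ((3-2*t)/6)) := by
        gcongr
        · rw [lintegral_const_mul _ (PK_meas _), ENNReal.ofReal_mul hb.le]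
          gcongr
          exact h1 R hR0
        · refine (ENNReal.lintegral_mul_le_Lp_mul_Lq volume hp (f := fun w => ENNReal.ofReal (f w))
            (g := fun w => (Metric.ball (0:E3) R)ᶜ.indicator (PK (3-2*t)) (z - w)) (by fun_prop)
            (m2.comp (by fun_prop)).aemeasurable).trans ?_
          rw [ENNReal.ofReal_mul (by positivity)]
          gcongr
          · simp_rw [fun x => ENNReal.ofReal_rpow_of_nonneg (hf0 x) hp.nonneg]
            rw [hfN, ENNReal.ofReal_rpow_of_pos hN, one_div_div]
          · rw [← ENNReal.ofReal_rpow_of_pos (by positivity), one_div_div]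
            gcongr
            refine le_trans (le_of_eq ?_) (h2 R hR0)
            rw [← lintegral_indicator measurableSet_ball.compl,
              lintegral_sub_left_eq_self (fun h => (Metric.ball (0:E3) R)ᶜ.indicator (PK (3-2*t)) h ^ (6 / (3-2*t))) z]
            refine lintegral_congr fun h => ?_
            by_cases hh : h ∈ (Metric.ball (0:E3) R)ᶜ
            · rw [Set.indicator_of_mem hh, Set.indicator_of_mem hh, PK_rpow _ _ hp.symm.nonneg]
              congr 1; field_simp
            · rw [Set.indicator_of_notMem hh, Set.indicator_of_notMem hh, ENNReal.zero_rpow_of_pos hp.symm.pos]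
    _ = _ := by
        rw [← ENNReal.ofReal_add (by positivity) (by positivity)]
        congr 1
        have e1 : b * R ^ (3 - (3 - 2*t)) = N ^ (2*t/3) * b ^ (6 / (3 + 2*t) - 1) := by
          rw [hR, Real.mul_rpow (by positivity) (by positivity), ← Real.rpow_mul hN.le,
            ← Real.rpow_mul hb.le, mul_left_comm]
          nth_rw 1 [← Real.rpow_one b]
          rw [← Real.rpow_add hb]
          congr 2
          · ring
          · field_simp; ring
        have e2 : N ^ ((3+2*t)/6) * (R ^ (3 - 6 : ℝ)) ^ ((3-2*t)/6) = N ^ (2*t/3) * b ^ (6 / (3 + 2*t) - 1) := by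
          rw [hR, ← Real.rpow_mul (by positivity), Real.mul_rpow (by positivity) (by positivity), ← Real.rpow_mul hN.le,
            ← Real.rpow_mul hb.le, ← mul_assoc, ← Real.rpow_add hN]
          congr 2
          · ring
          · field_simp; ring
        rw [Real.mul_rpow hC2.le (Real.rpow_nonneg hR0.le (3 - 6))]
        linear_combination C1 * e1 + C2 ^ ((3-2*t)/6) * e2

lemma hls (t : ℝ) (ht : 0 < t) (ht1 : t < 1) : ∃ C : ℝ, 0 < C ∧
    ∀ f : E3 → ℝ, Measurable f → (∀ x, 0 ≤ f x) →
    ∫⁻ z, ∫⁻ w, ENNReal.ofReal (f z) * ENNReal.ofReal (f w) * PK (3 - 2*t) (z - w) ≤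
      ENNReal.ofReal C *
        (∫⁻ x, ENNReal.ofReal (f x ^ (6 / (3 + 2*t)))) ^ ((3 + 2*t)/3) := by
  obtain ⟨C, hC, h⟩ := hls_inner t ht ht1
  refine ⟨2 * C, by positivity, fun f hf hf0 => ?_⟩
  have hp : 0 < 6 / (3 + 2*t) := by positivity
  have hPK := PK_meas (3 - 2*t)
  rcases eq_or_ne (∫⁻ x, ENNReal.ofReal (f x ^ (6 / (3 + 2*t)))) ⊤ with hT | hT
  · rw [hT, ENNReal.top_rpow_of_pos (by positivity), ENNReal.mul_top (by simpa using hC)]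
    exact le_top
  rcases eq_or_ne (∫⁻ x, ENNReal.ofReal (f x ^ (6 / (3 + 2*t)))) 0 with h0 | h0
  · rw [lintegral_eq_zero_iff (by fun_prop)] at h0
    have : ∫⁻ z, ∫⁻ w, ENNReal.ofReal (f z) * ENNReal.ofReal (f w) * PK (3 - 2*t) (z - w) = 0 := by
      rw [lintegral_eq_zero_iff (by fun_prop)]
      filter_upwards [h0] with z hz
      have hz : f z = 0 := by
        simp only [Pi.zero_apply, ENNReal.ofReal_eq_zero] at hz
        by_contra hne
        have := Real.rpow_pos_of_pos (lt_of_le_of_ne (hf0 z) (Ne.symm hne)) (6 / (3 + 2*t))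
        linarith
      simp [hz]
    rw [this]; exact zero_le
  set N := (∫⁻ x, ENNReal.ofReal (f x ^ (6 / (3 + 2*t)))).toReal with hNdef
  have hN : 0 < N := ENNReal.toReal_pos h0 hT
  have hfN : ∫⁻ x, ENNReal.ofReal (f x ^ (6 / (3 + 2*t))) = ENNReal.ofReal N :=
    (ENNReal.ofReal_toReal hT).symm
  set G : E3 → E3 → ENNReal := fun z w => {q : E3 × E3 | f q.2 ≤ f q.1}.indicator
      (fun q => ENNReal.ofReal (f q.1) * ENNReal.ofReal (f q.2) * PK (3 - 2*t) (q.1 - q.2)) (z, w) with hG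
  have hset : MeasurableSet {q : E3 × E3 | f q.2 ≤ f q.1} :=
    measurableSet_le (by fun_prop) (by fun_prop)
  have hGm : Measurable (Function.uncurry G) := by
    have : Measurable ({q : E3 × E3 | f q.2 ≤ f q.1}.indicator
      (fun q => ENNReal.ofReal (f q.1) * ENNReal.ofReal (f q.2) * PK (3 - 2*t) (q.1 - q.2))) :=
      Measurable.indicator (by fun_prop) hset
    exact this
  have hGi : ∫⁻ z, ∫⁻ w, G z w ≤ ENNReal.ofReal (C * N ^ (2*t/3)) * ENNReal.ofReal N := by
    rw [← hfN, ← lintegral_const_mul _ (by fun_prop)]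
    refine lintegral_mono fun z => ?_
    rcases eq_or_lt_of_le (hf0 z) with hz | hz
    · have : ∀ w, G z w = 0 := by
        intro w; simp [hG, ← hz, Set.indicator]
      simp [this]
    have e : ∀ w, G z w = ENNReal.ofReal (f z) *
        {w | f w ≤ f z}.indicator (fun w => ENNReal.ofReal (f w) * PK (3 - 2*t) (z - w)) w := by
      intro w
      by_cases hw : f w ≤ f z <;> simp [hG, hw, mul_assoc]
    simp_rw [e]
    rw [lintegral_const_mul _ (Measurable.indicator (by fun_prop) (measurableSet_le hf measurable_const))]
    refine (mul_le_mul_right (h f hf hf0 N hN hfN z (f z) hz) _).trans (le_of_eq ?_)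
    rw [← ENNReal.ofReal_mul (hf0 z), ← ENNReal.ofReal_mul (by positivity)]
    congr 1
    have : f z ^ (6 / (3 + 2*t)) = f z * f z ^ (6 / (3 + 2*t) - 1) := by
      nth_rw 2 [← Real.rpow_one (f z)]
      rw [← Real.rpow_add hz]; congr 1; ring
    rw [this]; ring
  calc _ ≤ ∫⁻ z, ∫⁻ w, (G z w + G w z) := by
        refine lintegral_mono fun z => lintegral_mono fun w => ?_
        rcases le_total (f w) (f z) with hw | hw
        · refine le_trans (le_of_eq ?_) le_self_add
          simp [hG, hw]
        · refine le_trans (le_of_eq ?_) le_add_self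
          simp only [hG, Set.mem_ofPred_eq, hw, Set.indicator_of_mem]
          rw [PK_symm, mul_comm (ENNReal.ofReal (f z))]
    _ = (∫⁻ z, ∫⁻ w, G z w) + ∫⁻ z, ∫⁻ w, G z w := by
        have hGs : Measurable (Function.uncurry fun z w => G w z) := hGm.comp measurable_swap
        simp_rw [fun z => lintegral_add_left (μ := volume) (f := G z) (hGm.of_uncurry_left) (fun w => G w z)]
        rw [lintegral_add_left (f := fun z => ∫⁻ w, G z w) (hGm.lintegral_prod_right')]
        congr 1
        exact lintegral_lintegral_swap hGs.aemeasurable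
    _ ≤ _ := by
        rw [← two_mul, hfN, ENNReal.ofReal_rpow_of_pos hN]
        refine (mul_le_mul_right hGi _).trans (le_of_eq ?_)
        have e : N ^ ((3 + 2*t)/3) = N ^ (2*t/3) * N := by
          nth_rw 3 [← Real.rpow_one N]
          rw [← Real.rpow_add hN]; congr 1; ring
        rw [ENNReal.ofReal_mul (p := 2) (by norm_num), ENNReal.ofReal_ofNat, mul_assoc, e,
          ← ENNReal.ofReal_mul (by positivity), ← ENNReal.ofReal_mul (by positivity), mul_assoc C]


lemma E3_ae_ne (a : E3) : ∀ᵐ x : E3, x ≠ a := by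
  rw [ae_iff]; simp

lemma It_sq (s : ℝ) (hs : 3/2 < s) (hs3 : s < 3) : ∃ C : ℝ, 0 < C ∧ ∀ F : E3 → ENNReal,
    Measurable F → ∫⁻ x, (∫⁻ z, F z * PK s (x - z)) ^ 2 ≤
      ENNReal.ofReal C * ∫⁻ z, ∫⁻ w, F z * F w * PK (2*s-3) (z - w) := by
  obtain ⟨C, hC, h⟩ := comp s hs hs3
  refine ⟨C, hC, fun F hF => ?_⟩
  have hP := PK_meas s
  have hP2 := PK_meas (2*s-3)
  have e : ∀ x, (∫⁻ z, F z * PK s (x - z)) ^ 2 =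
      ∫⁻ z, ∫⁻ w, (F z * PK s (x - z)) * (F w * PK s (x - w)) := by
    intro x
    rw [sq, ← lintegral_mul_const _ (by fun_prop)]
    refine lintegral_congr fun z => ?_
    rw [lintegral_const_mul _ (by fun_prop)]
  simp_rw [e]
  rw [lintegral_lintegral_swap (by fun_prop), ← lintegral_const_mul _ (by fun_prop)]
  refine lintegral_mono fun z => ?_
  rw [lintegral_lintegral_swap (by fun_prop), ← lintegral_const_mul _ (by fun_prop)]
  refine lintegral_mono_ae ?_
  filter_upwards [E3_ae_ne z] with w hw
  calc _ = ∫⁻ x, (F z * F w) * (PK s (x - z) * PK s (x - w)) := by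
        refine lintegral_congr fun x => ?_
        ring
    _ = F z * F w * ∫⁻ x, (PK s (x - z) * PK s (x - w)) := by
        rw [lintegral_const_mul _ (by fun_prop)]
    _ ≤ F z * F w * (ENNReal.ofReal C * PK (2*s-3) (z - w)) := by
        gcongr; exact h z w hw.symm
    _ = _ := by ring

/-- The modulus of continuity factor. -/
def qf (t r d : ℝ) : ENNReal := ENNReal.ofReal (r ^ t * min 1 (3 * d / r))

lemma real_diff (l a b d : ℝ) (hl : 0 < l) (hl3 : l ≤ 3) (ha : 0 < a) (hab : a ≤ b) (hd : b ≤ a + d) :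
    |a ^ (-l) - b ^ (-l)| ≤ a ^ (-l) * min 1 (3 * d / a) := by
  have hb : 0 < b := by linarith
  have h1 : b ^ (-l) ≤ a ^ (-l) := Real.rpow_le_rpow_of_nonpos ha hab (by linarith)
  have hbp : 0 < b ^ (-l) := by positivity
  have hap : 0 < a ^ (-l) := by positivity
  rw [abs_of_nonneg (by linarith)]
  have h2 : b ^ (-l) = a ^ (-l) * (a / b) ^ l := by
    rw [Real.div_rpow ha.le hb.le, Real.rpow_neg ha.le, Real.rpow_neg hb.le]
    field_simp
  rcases le_total 1 (3 * d / a) with h | h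
  · rw [min_eq_left h]; linarith
  · rw [min_eq_right h, h2]
    have h3 : (a / b) ^ (3:ℝ) ≤ (a / b) ^ l :=
      Real.rpow_le_rpow_of_exponent_ge (by positivity) (by rw [div_le_one hb]; exact hab) hl3
    have h4 : (a / b) ^ (3:ℝ) = (a/b)^3 := by norm_cast
    rw [h4] at h3
    have h5 : 1 - 3 * d / a ≤ (a/b)^3 := by
      have h6 : 1 - d / a ≤ a / b := by
        rw [le_div_iff₀ hb]
        have : (1 - d/a) * b ≤ a := by
          have : (1 - d/a) = (a - d)/a := by field_simp
          rw [this, div_mul_eq_mul_div, div_le_iff₀ ha]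
          nlinarith
        exact this
      have h7 : 1 + (3:ℕ) * (a/b - 1) ≤ (1 + (a/b - 1))^3 :=
        one_add_mul_le_pow (by have : 0 < a / b := by positivity
                               linarith) 3
      have h8 : 3 * d / a = 3 * (d/a) := by ring
      push_cast at h7
      have h9 : 1 + (a/b - 1) = a / b := by ring
      rw [h9] at h7
      linarith
    nlinarith

lemma kdiff (t : ℝ) (ht : 0 < t) (ht1 : t < 1) (a b : E3) (ha : a ≠ 0) (hab : ‖a‖ ≤ ‖b‖) :
    ENNReal.ofReal |‖a‖ ^ (-(3 - 2*t)) - ‖b‖ ^ (-(3 - 2*t))| ≤ PK (3 - t) a * qf t ‖a‖ ‖a - b‖ := by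
  have ha' := norm_pos_iff.2 ha
  rw [PK, qf, ← ENNReal.ofReal_mul (by positivity)]
  apply ENNReal.ofReal_le_ofReal
  have h : ‖b‖ ≤ ‖a‖ + ‖a - b‖ := by
    have := norm_sub_le a (a - b)
    simpa using this
  refine (real_diff (3 - 2*t) ‖a‖ ‖b‖ ‖a - b‖ (by linarith) (by linarith) ha' hab h).trans ?_
  rw [← mul_assoc, ← Real.rpow_add ha']
  apply le_of_eq; congr 2; ring

lemma toReal_sub_sq_le (a b D : ENNReal) (h1 : a ≤ b + D) (h2 : b ≤ a + D) :
    ENNReal.ofReal ((a.toReal - b.toReal) ^ 2) ≤ D ^ 2 := by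
  rcases eq_or_ne D ⊤ with hD | hD
  · simp [hD]
  rcases eq_or_ne a ⊤ with ha | ha
  · have hb : b = ⊤ := by
      by_contra hb
      exact absurd (top_le_iff.1 (ha ▸ h1)) (ENNReal.add_ne_top.2 ⟨hb, hD⟩)
    simp [ha, hb]
  have hb : b ≠ ⊤ := fun hb => absurd (top_le_iff.1 (hb ▸ h2)) (ENNReal.add_ne_top.2 ⟨ha, hD⟩)
  lift a to NNReal using ha
  lift b to NNReal using hb
  lift D to NNReal using hD
  have h1' : (a:ℝ) ≤ b + D := by exact_mod_cast h1
  have h2' : (b:ℝ) ≤ a + D := by exact_mod_cast h2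
  have : (D : ENNReal) = ENNReal.ofReal D := by simp
  rw [this, ← ENNReal.ofReal_pow (by positivity)]
  apply ENNReal.ofReal_le_ofReal
  simp only [ENNReal.coe_toReal]
  apply sq_le_sq'
  · linarith
  · linarith

lemma qf_meas (t : ℝ) : Measurable (fun q : ℝ × ℝ => qf t q.1 q.2) := by
  unfold qf; fun_prop

lemma phi_diff (t : ℝ) (ht : 0 < t) (ht1 : t < 1) (f : E3 → ℝ) (hf : Measurable f)
    (hf0 : ∀ x, 0 ≤ f x) (x y : E3) :
    ∫⁻ z, ENNReal.ofReal (f z / ‖x - z‖ ^ (3 - 2*t)) ≤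
    (∫⁻ z, ENNReal.ofReal (f z / ‖y - z‖ ^ (3 - 2*t))) +
     ((∫⁻ z, ENNReal.ofReal (f z) * PK (3 - t) (x - z) * qf t ‖x - z‖ ‖x - y‖) +
      ∫⁻ z, ENNReal.ofReal (f z) * PK (3 - t) (y - z) * qf t ‖y - z‖ ‖x - y‖) := by
  have hP := PK_meas (3 - t)
  have hq := qf_meas t
  have hq1 : ∀ x : E3, Measurable fun z => qf t ‖x - z‖ ‖x - y‖ := fun x =>
    hq.comp (f := fun z : E3 => (‖x - z‖, ‖x - y‖)) (by fun_prop)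
  have hq1 := hq1 x
  rw [← lintegral_add_left (by fun_prop), ← lintegral_add_left (by fun_prop)]
  refine lintegral_mono_ae ?_
  filter_upwards [E3_ae_ne x, E3_ae_ne y] with z hzx hzy
  have hx : x - z ≠ 0 := sub_ne_zero.2 hzx.symm
  have hy : y - z ≠ 0 := sub_ne_zero.2 hzy.symm
  have key : ENNReal.ofReal |‖x - z‖ ^ (-(3 - 2*t)) - ‖y - z‖ ^ (-(3 - 2*t))| ≤
      PK (3 - t) (x - z) * qf t ‖x - z‖ ‖x - y‖ + PK (3 - t) (y - z) * qf t ‖y - z‖ ‖x - y‖ := by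
    rcases le_total ‖x - z‖ ‖y - z‖ with h | h
    · have := kdiff t ht ht1 _ _ hx h
      rw [sub_sub_sub_cancel_right] at this
      exact this.trans le_self_add
    · have := kdiff t ht ht1 _ _ hy h
      rw [sub_sub_sub_cancel_right, abs_sub_comm, norm_sub_rev y x] at this
      exact this.trans le_add_self
  calc _ ≤ ENNReal.ofReal (f z / ‖y - z‖ ^ (3 - 2*t)) + ENNReal.ofReal (f z) *
        ENNReal.ofReal |‖x - z‖ ^ (-(3 - 2*t)) - ‖y - z‖ ^ (-(3 - 2*t))| := by
        have := hf0 z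
        rw [← ENNReal.ofReal_mul this, ← ENNReal.ofReal_add (by positivity) (by positivity)]
        apply ENNReal.ofReal_le_ofReal
        rw [div_eq_mul_inv, div_eq_mul_inv, ← Real.rpow_neg (norm_nonneg _), ← Real.rpow_neg (norm_nonneg _),
          ← mul_add]
        gcongr
        have := le_abs_self (‖x - z‖ ^ (-(3 - 2*t)) - ‖y - z‖ ^ (-(3 - 2*t)))
        linarith
    _ ≤ _ := by
        gcongr
        rw [mul_assoc, mul_assoc, ← mul_add]
        gcongr

lemma D1_bound (t : ℝ) (ht : 0 < t) (ht1 : t < 1) : ∃ C : ℝ, 0 < C ∧ ∀ F : E3 → ENNReal,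
    Measurable F → ∫⁻ x, ∫⁻ y, (∫⁻ z, F z * PK (3 - t) (x - z) * qf t ‖x - z‖ ‖x - y‖) ^ 2 *
      PK (3 + 2*t) (x - y) ≤ ENNReal.ofReal C * ∫⁻ x, (∫⁻ z, F z * PK (3 - t) (x - z)) ^ 2 := by
  obtain ⟨C, hC, h⟩ := q_lemma t ht ht1
  refine ⟨C, hC, fun F hF => ?_⟩
  have hP := PK_meas (3 - t)
  have hP2 := PK_meas (3 + 2*t)
  have hq := qf_meas t
  rw [← lintegral_const_mul _ (by fun_prop)]
  refine lintegral_mono fun x => ?_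
  have hq2 : Measurable fun q : E3 × E3 => qf t ‖x - q.2‖ ‖x - q.1‖ :=
    hq.comp (f := fun q : E3 × E3 => (‖x - q.2‖, ‖x - q.1‖)) (by fun_prop)
  have hq3 : ∀ y, Measurable fun z : E3 => qf t ‖x - z‖ ‖x - y‖ := fun y =>
    hq.comp (f := fun z : E3 => (‖x - z‖, ‖x - y‖)) (by fun_prop)
  have hq4 : ∀ z, Measurable fun y : E3 => qf t ‖x - z‖ ‖x - y‖ := fun z =>
    hq.comp (f := fun y : E3 => (‖x - z‖, ‖x - y‖)) (by fun_prop)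
  set I := ∫⁻ z, F z * PK (3 - t) (x - z) with hI
  calc _ ≤ ∫⁻ y, I * ∫⁻ z, F z * PK (3 - t) (x - z) * (qf t ‖x - z‖ ‖x - y‖ ^ 2 * PK (3 + 2*t) (x - y)) := by
        refine lintegral_mono fun y => ?_
        have := cs (fun z => F z * PK (3 - t) (x - z)) (fun z => qf t ‖x - z‖ ‖x - y‖) (by fun_prop) (hq3 y)
        refine (mul_le_mul_left this _).trans (le_of_eq ?_)
        have hq3y := hq3 y
        have e : ∫⁻ z, F z * PK (3 - t) (x - z) * (qf t ‖x - z‖ ‖x - y‖ ^ 2 * PK (3 + 2*t) (x - y)) =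
            (∫⁻ z, F z * PK (3 - t) (x - z) * qf t ‖x - z‖ ‖x - y‖ ^ 2) * PK (3 + 2*t) (x - y) := by
          rw [← lintegral_mul_const _ (by fun_prop)]
          refine lintegral_congr fun z => ?_
          ring
        rw [e, mul_assoc]
    _ = I * ∫⁻ z, F z * PK (3 - t) (x - z) * ∫⁻ y, qf t ‖x - z‖ ‖x - y‖ ^ 2 * PK (3 + 2*t) (x - y) := by
        have hm : Measurable (Function.uncurry fun y z : E3 =>
            F z * PK (3 - t) (x - z) * (qf t ‖x - z‖ ‖x - y‖ ^ 2 * PK (3 + 2*t) (x - y))) := by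
          have : Measurable fun q : E3 × E3 => F q.2 * PK (3 - t) (x - q.2) *
            (qf t ‖x - q.2‖ ‖x - q.1‖ ^ 2 * PK (3 + 2*t) (x - q.1)) := by fun_prop
          exact this
        have hm2 : Measurable fun y => ∫⁻ z, F z * PK (3 - t) (x - z) *
            (qf t ‖x - z‖ ‖x - y‖ ^ 2 * PK (3 + 2*t) (x - y)) := hm.lintegral_prod_right'
        rw [lintegral_const_mul _ hm2, lintegral_lintegral_swap hm.aemeasurable]
        congr 1
        refine lintegral_congr fun z => ?_
        have hq4z := hq4 z
        rw [lintegral_const_mul _ (by fun_prop)]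
    _ ≤ I * ∫⁻ z, F z * PK (3 - t) (x - z) * ENNReal.ofReal C := by
        refine mul_le_mul_right (lintegral_mono_ae ?_) _
        filter_upwards [E3_ae_ne x] with z hz
        refine mul_le_mul_right ?_ _
        exact h ‖x - z‖ (norm_pos_iff.2 (sub_ne_zero.2 hz.symm)) x
    _ = _ := by
        rw [lintegral_mul_const _ (by fun_prop), ← hI]; ring

lemma add_sq_le_ennreal (a b : ENNReal) : (a + b)^2 ≤ 2 * a^2 + 2 * b^2 := by
  have key : ∀ a b : ENNReal, a ≤ b → 2 * (a * b) ≤ a^2 + b^2 := by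
    intro a b h
    obtain ⟨c, rfl⟩ := le_iff_exists_add.1 h
    calc _ ≤ 2 * (a * (a + c)) + c^2 := le_self_add
      _ = _ := by ring
  have : 2 * (a * b) ≤ a^2 + b^2 := by
    rcases le_total a b with h | h
    · exact key a b h
    · rw [mul_comm a, add_comm]; exact key b a h
  calc (a+b)^2 = a^2 + b^2 + 2 * (a*b) := by ring
    _ ≤ a^2 + b^2 + (a^2+b^2) := by gcongr
    _ = _ := by ring

/-- One-sided difference integral. -/
def DK (t : ℝ) (f : E3 → ℝ) (x y : E3) : ENNReal :=
  ∫⁻ z, ENNReal.ofReal (f z) * PK (3 - t) (x - z) * qf t ‖x - z‖ ‖x - y‖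

/-- Integrand of the one-sided seminorm. -/
def HK (t : ℝ) (f : E3 → ℝ) (x y : E3) : ENNReal := DK t f x y ^ 2 * PK (3 + 2*t) (x - y)

lemma DK_meas (t : ℝ) (f : E3 → ℝ) (hf : Measurable f) :
    Measurable (fun q : E3 × E3 => DK t f q.1 q.2) := by
  have hP := PK_meas (3 - t)
  have hq2 : Measurable fun q : (E3 × E3) × E3 => qf t ‖q.1.1 - q.2‖ ‖q.1.1 - q.1.2‖ :=
    (qf_meas t).comp (f := fun q : (E3 × E3) × E3 => (‖q.1.1 - q.2‖, ‖q.1.1 - q.1.2‖)) (by fun_prop)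
  have hP1 : Measurable fun q : (E3 × E3) × E3 => PK (3 - t) (q.1.1 - q.2) :=
    by fun_prop
  have hf1 : Measurable fun q : (E3 × E3) × E3 => ENNReal.ofReal (f q.2) := by fun_prop
  exact ((hf1.mul hP1).mul hq2).lintegral_prod_right'

lemma HK_meas (t : ℝ) (f : E3 → ℝ) (hf : Measurable f) :
    Measurable (Function.uncurry (HK t f)) := by
  have h1 := DK_meas t f hf
  have hP := PK_meas (3 + 2 * t)
  have hP1 : Measurable fun q : E3 × E3 => PK (3 + 2 * t) (q.1 - q.2) := by fun_prop
  exact (h1.pow_const 2).mul hP1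

lemma HK_meas_swap (t : ℝ) (f : E3 → ℝ) (hf : Measurable f) :
    Measurable (Function.uncurry fun x y => HK t f y x) := by
  have h1 : Measurable (fun q : E3 × E3 => DK t f q.2 q.1) :=
    (DK_meas t f hf).comp (f := fun q : E3 × E3 => (q.2, q.1)) (by fun_prop)
  have hP := PK_meas (3 + 2 * t)
  have hP1 : Measurable fun q : E3 × E3 => PK (3 + 2 * t) (q.2 - q.1) := by fun_prop
  exact (h1.pow_const 2).mul hP1

set_option maxHeartbeats 400000 in
lemma riesz_aux
    (t : ℝ) (ht : t ∈ Set.Ioo (0 : ℝ) 1) :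
    ∃ C : ℝ, 0 < C ∧
      ∀ u : EuclideanSpace ℝ (Fin 3) → ℝ, Measurable u →
        ∀ φ : EuclideanSpace ℝ (Fin 3) → ℝ,
        (φ = fun x =>
          (∫⁻ y, ENNReal.ofReal ((u y) ^ 2 / ‖x - y‖ ^ (3 - 2 * t))).toReal) →
        (∫⁻ x, ∫⁻ y,
            ENNReal.ofReal ((φ x - φ y) ^ 2 / ‖x - y‖ ^ (3 + 2 * t))) ≤
          ENNReal.ofReal C *
            (∫⁻ x, ENNReal.ofReal (|u x| ^ (12 / (3 + 2 * t)))) ^ ((3 + 2 * t) / 3) := by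
  obtain ⟨ht0, ht1⟩ := ht
  obtain ⟨C1, hC1, h1⟩ := D1_bound t ht0 ht1
  obtain ⟨C2, hC2, h2⟩ := It_sq (3 - t) (by linarith) (by linarith)
  obtain ⟨C3, hC3, h3⟩ := hls t ht0 ht1
  refine ⟨4 * (C1 * (C2 * C3)), by positivity, fun u hu φ hφ => ?_⟩
  set f : E3 → ℝ := fun x => u x ^ 2 with hfdef
  have hf : Measurable f := by fun_prop
  have hf0 : ∀ x, 0 ≤ f x := fun x => sq_nonneg _
  have hP := PK_meas (3 - t)
  have hP2 := PK_meas (3 + 2*t)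
  have hq := qf_meas t
  set H : E3 → E3 → ENNReal := HK t f with hH
  have hHm : Measurable (Function.uncurry H) := HK_meas t f hf
  have hHs : Measurable (Function.uncurry fun x y => H y x) := HK_meas_swap t f hf
  clear_value H
  have hpt : ∀ x y, ENNReal.ofReal ((φ x - φ y) ^ 2 / ‖x - y‖ ^ (3 + 2 * t)) ≤ 2 * H x y + 2 * H y x := by
    intro x y
    have a1 := phi_diff t ht0 ht1 f hf hf0 x y
    have a2 := phi_diff t ht0 ht1 f hf hf0 y x
    rw [norm_sub_rev y x, add_comm (∫⁻ z, ENNReal.ofReal (f z) * PK (3 - t) (y - z) * _)] at a2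
    have a3 := toReal_sub_sq_le _ _ _ a1 a2
    have a4 : φ x = (∫⁻ z, ENNReal.ofReal (f z / ‖x - z‖ ^ (3 - 2*t))).toReal := by rw [hφ]
    have a5 : φ y = (∫⁻ z, ENNReal.ofReal (f z / ‖y - z‖ ^ (3 - 2*t))).toReal := by rw [hφ]
    rw [← a4, ← a5] at a3
    have a6 := a3.trans (add_sq_le_ennreal _ _)
    rw [div_eq_mul_inv, ← Real.rpow_neg (norm_nonneg _), ENNReal.ofReal_mul (by positivity)]
    refine (mul_le_mul_left a6 _).trans (le_of_eq ?_)
    simp only [hH, HK, DK]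
    rw [PK_symm _ y x, norm_sub_rev y x, add_mul, mul_assoc, mul_assoc]
    rfl
  have hrhs : ∫⁻ x, ENNReal.ofReal (f x ^ (6 / (3 + 2*t))) =
      ∫⁻ x, ENNReal.ofReal (|u x| ^ (12 / (3 + 2 * t))) := by
    refine lintegral_congr fun x => ?_
    congr 1
    rw [hfdef]
    simp only
    rw [← sq_abs, ← Real.rpow_natCast, ← Real.rpow_mul (abs_nonneg _)]
    congr 1; push_cast; ring
  have hHH : ∫⁻ x, ∫⁻ y, H x y ≤ ENNReal.ofReal C1 * (ENNReal.ofReal C2 * (ENNReal.ofReal C3 *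
      (∫⁻ x, ENNReal.ofReal (|u x| ^ (12 / (3 + 2 * t)))) ^ ((3 + 2 * t) / 3))) := by
    rw [hH]
    refine (h1 (fun z => ENNReal.ofReal (f z)) (by fun_prop)).trans ?_
    refine mul_le_mul_right ?_ _
    refine (h2 (fun z => ENNReal.ofReal (f z)) (by fun_prop)).trans ?_
    refine mul_le_mul_right ?_ _
    rw [← hrhs]
    have e : 2 * (3 - t) - 3 = 3 - 2*t := by ring
    rw [e]
    exact h3 f hf hf0
  calc _ ≤ ∫⁻ x, ∫⁻ y, (2 * H x y + 2 * H y x) :=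
        lintegral_mono fun x => lintegral_mono fun y => hpt x y
    _ = 2 * (∫⁻ x, ∫⁻ y, H x y) + 2 * ∫⁻ x, ∫⁻ y, H y x := by
        have e : ∀ x, ∫⁻ y, (2 * H x y + 2 * H y x) = 2 * (∫⁻ y, H x y) + 2 * ∫⁻ y, H y x := by
          intro x
          have m1 : Measurable (fun y => H x y) := hHm.of_uncurry_left
          have m2 : Measurable (fun y => H y x) := hHs.of_uncurry_left (x := x)
          rw [lintegral_add_left (m1.const_mul 2), lintegral_const_mul _ m1, lintegral_const_mul _ m2]
        have n1 : Measurable (fun x => ∫⁻ y, H x y) := hHm.lintegral_prod_right'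
        have n2 : Measurable (fun x => ∫⁻ y, H y x) := hHs.lintegral_prod_right'
        simp_rw [e]
        rw [lintegral_add_left (n1.const_mul 2), lintegral_const_mul _ n1, lintegral_const_mul _ n2]
    _ = 4 * ∫⁻ x, ∫⁻ y, H x y := by
        rw [lintegral_lintegral_swap hHs.aemeasurable]; ring
    _ ≤ _ := by
        refine (mul_le_mul_right hHH _).trans (le_of_eq ?_)
        rw [ENNReal.ofReal_mul (by norm_num), ENNReal.ofReal_mul hC1.le, ENNReal.ofReal_mul hC2.le,
          ENNReal.ofReal_ofNat]
        ring

/-- The Riesz potential `φ_u(x) = ∫ u(y)²/|x−y|^{3−2t} dy` satisfies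
`[φ_u]_t² ≤ C ‖u‖⁴_{L^{12/(3+2t)}}`. -/
theorem riesz_potential_seminorm_bound
    (t : ℝ) (ht : t ∈ Set.Ioo (0 : ℝ) 1) :
    ∃ C : ℝ, 0 < C ∧
      ∀ u : EuclideanSpace ℝ (Fin 3) → ℝ, Measurable u →
        ∀ φ : EuclideanSpace ℝ (Fin 3) → ℝ,
        (φ = fun x =>
          (∫⁻ y, ENNReal.ofReal ((u y) ^ 2 / ‖x - y‖ ^ (3 - 2 * t))).toReal) →
        (∫⁻ x, ∫⁻ y,
            ENNReal.ofReal ((φ x - φ y) ^ 2 / ‖x - y‖ ^ (3 + 2 * t))) ≤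
          ENNReal.ofReal C *
            (∫⁻ x, ENNReal.ofReal (|u x| ^ (12 / (3 + 2 * t)))) ^ ((3 + 2 * t) / 3) := by
  exact riesz_aux t ht
end
end
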